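/- arXiv:2109.05998 — 4 statements merged into one kernel-verified Lean document; each statement's English description precedes it below -/
import Mathlib

section
/- Let A be an n×n real symmetric positive definite matrix, let θ ∈ ℝⁿ with θ ≠ 0, let x ∈ ℝⁿ with x ≠ 0, and set λ := exp(θᵀAθ). Then λ(λ − 1)·(xᵀAx) − (θᵀAx)² > 0. -/
open Matrix

/-- Cauchy–Schwarz for the bilinear form of a real positive semidefinite matrix. -/
theorem Matrix.PosSemidef.sq_dotProduct_mulVec_le {ι : Type*} [Fintype ι]
    {A : Matrix ι ι ℝ} (hA : A.PosSemidef) (x y : ι → ℝ) :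
    (x ⬝ᵥ (A *ᵥ y)) ^ 2 ≤ (x ⬝ᵥ (A *ᵥ x)) * (y ⬝ᵥ (A *ᵥ y)) := by
  classical
  have hsymm : (Matrix.toLinearMap₂' ℝ A).IsSymm := by
    refine ⟨fun u v ↦ ?_⟩
    have hT : Aᵀ = A := by simpa using hA.isHermitian.eq
    simp only [Matrix.toLinearMap₂'_apply', RingHom.id_apply]
    rw [dotProduct_mulVec, ← mulVec_transpose, hT, dotProduct_comm]
  have hnonneg (u : ι → ℝ) : 0 ≤ Matrix.toLinearMap₂' ℝ A u u := by
    simpa [Matrix.toLinearMap₂'_apply'] using hA.dotProduct_mulVec_nonneg u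
  simpa only [Matrix.toLinearMap₂'_apply'] using
    LinearMap.BilinForm.apply_sq_le_of_symm _ hnonneg hsymm x y

theorem Real.lt_exp_mul_exp_sub_one {a : ℝ} (ha : 0 < a) :
    a < Real.exp a * (Real.exp a - 1) := by
  nlinarith [Real.add_one_lt_exp ha.ne']

/-- key inequality in the proof of Theorem 1(iii): for a symmetric positive
definite matrix `A`, nonzero vectors `θ` and `x`, and `λ = exp(θᵀAθ)`, one has
`λ(λ − 1)·(xᵀAx) − (θᵀAx)² > 0`. -/
theorem lambda_cauchy_schwarz_inequality
    (n : ℕ) (A : Matrix (Fin n) (Fin n) ℝ) (hA : A.PosDef)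
    (θ x : Fin n → ℝ) (hθ : θ ≠ 0) (hx : x ≠ 0) :
    Real.exp (θ ⬝ᵥ (A *ᵥ θ)) * (Real.exp (θ ⬝ᵥ (A *ᵥ θ)) - 1) * (x ⬝ᵥ (A *ᵥ x))
      - (θ ⬝ᵥ (A *ᵥ x)) ^ 2 > 0 := by
  have hpos {v : Fin n → ℝ} (hv : v ≠ 0) : 0 < v ⬝ᵥ (A *ᵥ v) := by
    simpa using hA.dotProduct_mulVec_pos hv
  refine sub_pos.mpr ((hA.posSemidef.sq_dotProduct_mulVec_le θ x).trans_lt ?_)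
  exact mul_lt_mul_of_pos_right (Real.lt_exp_mul_exp_sub_one (hpos hθ)) (hpos hx)
end

section
/- Let Z₁, Z₂ be independent standard normal random variables and let μ₁, μ₂, a, b, c ∈ ℝ with (a−b)² + c² > 0. Define X₁ := μ₁ + a·Z₁ and X₂ := μ₂ + b·Z₁ + c·Z₂, so that (X₁,X₂) is bivariate normal with means μ₁, μ₂, variances σ₁² = a², σ₂² = b² + c², and covariance σ₁₂ = ab. Then E[(e^{X₁} − e^{X₂})⁺] = exp(μ₁ + σ₁²/2)·Φ((μ₁ − μ₂ + σ₁² − σ₁₂)/√(σ₁² − 2σ₁₂ + σ₂²)) − exp(μ₂ + σ₂²/2)·Φ((μ₁ − μ₂ + σ₁₂ − σ₂²)/√(σ₁² − 2σ₁₂ + σ₂²)). -/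
open MeasureTheory ProbabilityTheory

/-- The standard normal density `φ(x) = (2π)^{−1/2} e^{−x²/2}`. -/
noncomputable def stdNormalPdf (x : ℝ) : ℝ :=
  (Real.sqrt (2 * Real.pi))⁻¹ * Real.exp (-x ^ 2 / 2)

/-- The standard normal cumulative distribution function `Φ(x) = ∫_{−∞}^x φ(u) du`. -/
noncomputable def stdNormalCdf (x : ℝ) : ℝ :=
  ∫ u in Set.Iic x, stdNormalPdf u

/-- A random variable with the moment-generating function of a Gaussian law has that law. -/
theorem map_eq_gaussianReal_of_mgf_eq {Ω : Type*} [MeasurableSpace Ω] {P : Measure Ω}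
    [IsProbabilityMeasure P] {X : Ω → ℝ} (hX : AEMeasurable X P) {m : ℝ} {v : NNReal}
    (h : ∀ t, mgf X P t = Real.exp (m * t + v * t ^ 2 / 2)) :
    P.map X = gaussianReal m v := by
  have hset : integrableExpSet X P = Set.univ := by
    ext t
    simp only [integrableExpSet, Set.mem_ofPred_eq, Set.mem_univ, iff_true]
    rw [← mgf_pos_iff, h]
    exact Real.exp_pos _
  have hmgf : mgf X P = mgf id (gaussianReal m v) := by
    rw [mgf_id_gaussianReal]
    exact funext h
  have hc : complexMGF X P = complexMGF id (gaussianReal m v) := by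
    ext z
    refine eqOn_complexMGF_of_mgf hmgf ?_
    simp [hset]
  simpa using Measure.ext_of_complexMGF_eq hX aemeasurable_id hc

/-- The distribution function of a unit-variance Gaussian, in terms of the standard one. -/
theorem gaussianReal_one_real_Iic (m k : ℝ) :
    (gaussianReal m 1).real (Set.Iic k) = stdNormalCdf (k - m) := by
  have hpdf : gaussianPDFReal 0 1 = stdNormalPdf := by
    ext x
    simp [gaussianPDFReal, stdNormalPdf]
  have hmap : gaussianReal m 1 (Set.Iic k) = gaussianReal 0 1 (Set.Iic (k - m)) := by
    rw [← sub_self m, ← gaussianReal_map_sub_const m,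
      Measure.map_apply (by fun_prop) measurableSet_Iic]
    congr 1
    ext x
    simp
  rw [measureReal_def, hmap, gaussianReal_apply_eq_integral _ one_ne_zero, hpdf,
    ENNReal.toReal_ofReal, stdNormalCdf]
  exact integral_nonneg fun x => by unfold stdNormalPdf; positivity

section StandardNormalPair

variable {Ω : Type*} [MeasurableSpace Ω] {P : Measure Ω} {Z1 Z2 : Ω → ℝ}

theorem integral_exp_standardNormal_pair (hZ1m : Measurable Z1) (hZ2m : Measurable Z2)
    (hZ1 : Measure.map Z1 P = gaussianReal 0 1) (hZ2 : Measure.map Z2 P = gaussianReal 0 1)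
    (hindep : IndepFun Z1 Z2 P) (p q : ℝ) :
    ∫ ω, Real.exp (p * Z1 ω + q * Z2 ω) ∂P = Real.exp ((p ^ 2 + q ^ 2) / 2) := by
  have hmul := (hindep.exp_mul p q).integral_mul_eq_mul_integral
    (by fun_prop) (by fun_prop)
  have h1 := mgf_gaussianReal hZ1 p
  have h2 := mgf_gaussianReal hZ2 q
  simp only [mgf] at h1 h2
  simp only [Pi.mul_def] at hmul
  simp_rw [Real.exp_add]
  rw [hmul, h1, h2, ← Real.exp_add]
  congr 1
  push_cast
  ring

theorem integrable_exp_standardNormal_pair (hZ1m : Measurable Z1) (hZ2m : Measurable Z2)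
    (hZ1 : Measure.map Z1 P = gaussianReal 0 1) (hZ2 : Measure.map Z2 P = gaussianReal 0 1)
    (hindep : IndepFun Z1 Z2 P) (p q : ℝ) :
    Integrable (fun ω => Real.exp (p * Z1 ω + q * Z2 ω)) P := by
  by_contra h
  have h0 := integral_exp_standardNormal_pair hZ1m hZ2m hZ1 hZ2 hindep p q
  rw [integral_undef h] at h0
  exact (Real.exp_pos _).ne h0

/-- Exponential tilting of a pair of independent standard normals shifts the mean of every
normalized linear combination. -/
theorem map_tilted_standardNormal_pair [IsProbabilityMeasure P]
    (hZ1m : Measurable Z1) (hZ2m : Measurable Z2)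
    (hZ1 : Measure.map Z1 P = gaussianReal 0 1) (hZ2 : Measure.map Z2 P = gaussianReal 0 1)
    (hindep : IndepFun Z1 Z2 P) (p q : ℝ) {α β : ℝ} (hαβ : α ^ 2 + β ^ 2 = 1) :
    (P.tilted fun ω => p * Z1 ω + q * Z2 ω).map (fun ω => α * Z1 ω + β * Z2 ω) =
      gaussianReal (α * p + β * q) 1 := by
  have := isProbabilityMeasure_tilted
    (integrable_exp_standardNormal_pair hZ1m hZ2m hZ1 hZ2 hindep p q)
  refine map_eq_gaussianReal_of_mgf_eq (by fun_prop) fun t => ?_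
  have hcongr : ∀ ω, ((fun ω => p * Z1 ω + q * Z2 ω) + fun ω => t * (α * Z1 ω + β * Z2 ω)) ω =
      (p + t * α) * Z1 ω + (q + t * β) * Z2 ω := fun ω => by
    simp only [Pi.add_apply]
    ring
  rw [mgf, integral_exp_tilted]
  simp_rw [hcongr]
  rw [integral_exp_standardNormal_pair hZ1m hZ2m hZ1 hZ2 hindep,
    integral_exp_standardNormal_pair hZ1m hZ2m hZ1 hZ2 hindep, ← Real.exp_sub]
  congr 1
  push_cast
  linear_combination t ^ 2 / 2 * hαβ

theorem setIntegral_exp_standardNormal_pair [IsProbabilityMeasure P]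
    (hZ1m : Measurable Z1) (hZ2m : Measurable Z2)
    (hZ1 : Measure.map Z1 P = gaussianReal 0 1) (hZ2 : Measure.map Z2 P = gaussianReal 0 1)
    (hindep : IndepFun Z1 Z2 P) (p q : ℝ) {α β : ℝ} (hαβ : α ^ 2 + β ^ 2 = 1) (k : ℝ) :
    ∫ ω in {ω | α * Z1 ω + β * Z2 ω ≤ k}, Real.exp (p * Z1 ω + q * Z2 ω) ∂P =
      Real.exp ((p ^ 2 + q ^ 2) / 2) * stdNormalCdf (k - (α * p + β * q)) := by
  have hE := integral_exp_standardNormal_pair hZ1m hZ2m hZ1 hZ2 hindep p q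
  rw [← gaussianReal_one_real_Iic,
    ← map_tilted_standardNormal_pair hZ1m hZ2m hZ1 hZ2 hindep p q hαβ,
    map_measureReal_apply (by fun_prop) measurableSet_Iic, measureReal_def,
    tilted_apply_eq_ofReal_integral, hE, integral_div, ENNReal.toReal_ofReal,
    mul_div_cancel₀ _ (Real.exp_ne_zero _)]
  · rfl
  · positivity

end StandardNormalPair


/-- Lemma 5, Margrabe exchange-option formula: for independent standard
normals `Z₁, Z₂` and `X₁ = μ₁ + aZ₁`, `X₂ = μ₂ + bZ₁ + cZ₂` (so `σ₁² = a²`,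
`σ₂² = b² + c²`, `σ₁₂ = ab`) with `(a−b)² + c² > 0`,
`E[(e^{X₁} − e^{X₂})⁺] = e^{μ₁+σ₁²/2}Φ((μ₁−μ₂+σ₁²−σ₁₂)/√(σ₁²−2σ₁₂+σ₂²))
  − e^{μ₂+σ₂²/2}Φ((μ₁−μ₂+σ₁₂−σ₂²)/√(σ₁²−2σ₁₂+σ₂²))`. -/
theorem margrabe_exchange_formula
    {Ω : Type*} [MeasurableSpace Ω] (P : Measure Ω) [IsProbabilityMeasure P]
    (Z1 Z2 : Ω → ℝ) (hZ1m : Measurable Z1) (hZ2m : Measurable Z2)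
    (hZ1 : Measure.map Z1 P = gaussianReal 0 1)
    (hZ2 : Measure.map Z2 P = gaussianReal 0 1)
    (hindep : IndepFun Z1 Z2 P)
    (μ1 μ2 a b c : ℝ) (hpos : (a - b) ^ 2 + c ^ 2 > 0) :
    ∫ ω, max (Real.exp (μ1 + a * Z1 ω) - Real.exp (μ2 + b * Z1 ω + c * Z2 ω)) 0 ∂P =
      Real.exp (μ1 + a ^ 2 / 2) *
        stdNormalCdf ((μ1 - μ2 + a ^ 2 - a * b) /
          Real.sqrt (a ^ 2 - 2 * (a * b) + (b ^ 2 + c ^ 2))) -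
      Real.exp (μ2 + (b ^ 2 + c ^ 2) / 2) *
        stdNormalCdf ((μ1 - μ2 + a * b - (b ^ 2 + c ^ 2)) /
          Real.sqrt (a ^ 2 - 2 * (a * b) + (b ^ 2 + c ^ 2))) := by
  have hs2 : a ^ 2 - 2 * (a * b) + (b ^ 2 + c ^ 2) = (a - b) ^ 2 + c ^ 2 := by ring
  rw [hs2]
  set s := Real.sqrt ((a - b) ^ 2 + c ^ 2) with hs
  have hs0 : 0 < s := Real.sqrt_pos.2 hpos
  have hsq : s ^ 2 = (a - b) ^ 2 + c ^ 2 := Real.sq_sqrt hpos.le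
  have hunit : ((b - a) / s) ^ 2 + (c / s) ^ 2 = 1 := by
    field_simp
    linarith
  set A := {ω | (b - a) / s * Z1 ω + c / s * Z2 ω ≤ (μ1 - μ2) / s} with hA
  have hAm : MeasurableSet A := measurableSet_le (by fun_prop) measurable_const
  have hmem : ∀ ω, ω ∈ A ↔ μ2 + b * Z1 ω + c * Z2 ω ≤ μ1 + a * Z1 ω := fun ω => by
    have : (b - a) / s * Z1 ω + c / s * Z2 ω = ((b - a) * Z1 ω + c * Z2 ω) / s := by ring
    rw [hA, Set.mem_ofPred_eq, this, div_le_div_iff_of_pos_right hs0]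
    constructor <;> intro h <;> linarith
  have hpayoff : ∀ ω,
      max (Real.exp (μ1 + a * Z1 ω) - Real.exp (μ2 + b * Z1 ω + c * Z2 ω)) 0 =
        A.indicator (fun ω => Real.exp μ1 * Real.exp (a * Z1 ω + 0 * Z2 ω) -
          Real.exp μ2 * Real.exp (b * Z1 ω + c * Z2 ω)) ω := fun ω => by
    by_cases h : ω ∈ A
    · rw [Set.indicator_of_mem h, max_eq_left
        (sub_nonneg.2 (Real.exp_le_exp.2 ((hmem ω).1 h))), ← Real.exp_add, ← Real.exp_add]
      simp [add_assoc]
    · rw [Set.indicator_of_notMem h, max_eq_right]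
      exact sub_nonpos.2 (Real.exp_le_exp.2 (not_le.1 (mt (hmem ω).2 h)).le)
  have hint (p q : ℝ) := integrable_exp_standardNormal_pair hZ1m hZ2m hZ1 hZ2 hindep p q
  simp_rw [hpayoff]
  rw [integral_indicator hAm, integral_sub ((hint a 0).integrableOn.const_mul _)
    ((hint b c).integrableOn.const_mul _), integral_const_mul, integral_const_mul,
    setIntegral_exp_standardNormal_pair hZ1m hZ2m hZ1 hZ2 hindep a 0 hunit,
    setIntegral_exp_standardNormal_pair hZ1m hZ2m hZ1 hZ2 hindep b c hunit,
    ← mul_assoc, ← mul_assoc, ← Real.exp_add, ← Real.exp_add]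
  congr 3
  · ring
  · ring
  · ring
end

section
/- Let X be a real random variable with distribution N(μ,σ²), where σ > 0, and let K > 0. Set d₁ := (μ + σ² − ln K)/σ and d₂ := d₁ − σ. Then E[(e^X − K)⁺] = exp(μ + σ²/2)·Φ(d₁) − K·Φ(d₂) and E[(K − e^X)⁺] = K·Φ(−d₂) − exp(μ + σ²/2)·Φ(−d₁). -/
open MeasureTheory ProbabilityTheory

lemma stdNormalPdf_eq_gaussianPDFReal : stdNormalPdf = gaussianPDFReal 0 1 := by
  ext x
  simp [stdNormalPdf, gaussianPDFReal]

lemma integrable_stdNormalPdf : Integrable stdNormalPdf := by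
  rw [stdNormalPdf_eq_gaussianPDFReal]
  exact integrable_gaussianPDFReal 0 1

/-- Completing the square in the exponent of the normal density. -/
lemma exp_mul_stdNormalPdf (μ s z : ℝ) :
    Real.exp (μ + s * z) * stdNormalPdf z =
      Real.exp (μ + s ^ 2 / 2) * stdNormalPdf (z - s) := by
  unfold stdNormalPdf
  rw [mul_left_comm, mul_left_comm (Real.exp (μ + s ^ 2 / 2)), ← Real.exp_add, ← Real.exp_add]
  ring_nf

lemma setIntegral_Iic_stdNormalPdf_sub (s c : ℝ) :
    ∫ z in Set.Iic c, stdNormalPdf (z - s) = stdNormalCdf (c - s) := by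
  have h := (measurePreserving_sub_right volume s).setIntegral_preimage_emb
    (measurableEmbedding_subRight s) stdNormalPdf (Set.Iic (c - s))
  simpa [stdNormalCdf] using h

lemma integrable_exp_mul_stdNormalPdf (μ s : ℝ) :
    Integrable fun z ↦ Real.exp (μ + s * z) * stdNormalPdf z := by
  simp_rw [exp_mul_stdNormalPdf]
  exact (integrable_stdNormalPdf.comp_sub_right s).const_mul _

lemma setIntegral_Iic_exp_mul_stdNormalPdf (μ s c : ℝ) :
    ∫ z in Set.Iic c, Real.exp (μ + s * z) * stdNormalPdf z =
      Real.exp (μ + s ^ 2 / 2) * stdNormalCdf (c - s) := by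
  simp_rw [exp_mul_stdNormalPdf]
  rw [integral_const_mul, setIntegral_Iic_stdNormalPdf_sub]

lemma setIntegral_Iic_exp_sub_mul_stdNormalPdf (μ s K c : ℝ) :
    ∫ z in Set.Iic c, (Real.exp (μ + s * z) - K) * stdNormalPdf z =
      Real.exp (μ + s ^ 2 / 2) * stdNormalCdf (c - s) - K * stdNormalCdf c := by
  simp_rw [sub_mul]
  rw [integral_sub (integrable_exp_mul_stdNormalPdf μ s).integrableOn
    (integrable_stdNormalPdf.const_mul K).integrableOn,
    setIntegral_Iic_exp_mul_stdNormalPdf, integral_const_mul, stdNormalCdf, stdNormalCdf]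

lemma integral_gaussianReal_eq_integral_stdNormalPdf (μ s : ℝ) {f : ℝ → ℝ} (hf : Continuous f) :
    ∫ x, f x ∂gaussianReal μ (Real.toNNReal (s ^ 2)) =
      ∫ z, f (μ + s * z) * stdNormalPdf z := by
  have hlaw : (gaussianReal 0 1).map (fun z ↦ μ + s * z) =
      gaussianReal μ (Real.toNNReal (s ^ 2)) := by
    rw [← Function.comp_def (fun x ↦ μ + x) (fun z ↦ s * z),
      ← Measure.map_map (by fun_prop) (by fun_prop), gaussianReal_map_const_mul,
      gaussianReal_map_const_add, Real.toNNReal_of_nonneg (sq_nonneg s)]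
    simp
  rw [← hlaw, integral_map (by fun_prop) hf.aestronglyMeasurable,
    integral_gaussianReal_eq_integral_smul one_ne_zero, stdNormalPdf_eq_gaussianPDFReal]
  simp [mul_comm]

lemma integral_max_zero_mul_eq_setIntegral {g φ : ℝ → ℝ} {c : ℝ}
    (hg : ∀ z, 0 ≤ g z ↔ z ≤ c) :
    ∫ z, max (g z) 0 * φ z = ∫ z in Set.Iic c, g z * φ z := by
  rw [← integral_indicator measurableSet_Iic]
  congr 1 with z
  by_cases hz : z ≤ c
  · simp [hz, (hg z).2 hz]
  · have h : g z ≤ 0 := (not_le.1 fun h ↦ hz ((hg z).1 h)).le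
    simp [hz, h]

/-- Lemma 6, Black–Scholes-type lemma: for `X ∼ N(μ,σ²)` with `σ > 0`,
`K > 0`, `d₁ = (μ + σ² − ln K)/σ` and `d₂ = d₁ − σ`,
`E[(e^X − K)⁺] = e^{μ+σ²/2}Φ(d₁) − KΦ(d₂)` and
`E[(K − e^X)⁺] = KΦ(−d₂) − e^{μ+σ²/2}Φ(−d₁)`. -/
theorem lognormal_call_put_expectation
    {Ω : Type*} [MeasurableSpace Ω] (P : Measure Ω) [IsProbabilityMeasure P]
    (μ σ : ℝ) (hσ : 0 < σ)
    (X : Ω → ℝ) (hXm : Measurable X)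
    (hX : Measure.map X P = gaussianReal μ (Real.toNNReal (σ ^ 2)))
    (K : ℝ) (hK : 0 < K)
    (d1 d2 : ℝ) (hd1 : d1 = (μ + σ ^ 2 - Real.log K) / σ) (hd2 : d2 = d1 - σ) :
    (∫ ω, max (Real.exp (X ω) - K) 0 ∂P =
      Real.exp (μ + σ ^ 2 / 2) * stdNormalCdf d1 - K * stdNormalCdf d2) ∧
    (∫ ω, max (K - Real.exp (X ω)) 0 ∂P =
      K * stdNormalCdf (-d2) - Real.exp (μ + σ ^ 2 / 2) * stdNormalCdf (-d1)) := by
  have law (f : ℝ → ℝ) (hf : Continuous f) :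
      ∫ ω, f (X ω) ∂P = ∫ x, f x ∂gaussianReal μ (Real.toNNReal (σ ^ 2)) := by
    rw [← hX, integral_map hXm.aemeasurable hf.aestronglyMeasurable]
  have hd2' : σ * d2 = μ - Real.log K := by
    rw [hd2, hd1]
    field_simp
    ring
  constructor
  · have hsign (z : ℝ) : 0 ≤ Real.exp (μ + -σ * z) - K ↔ z ≤ d2 := by
      rw [sub_nonneg, ← Real.log_le_iff_le_exp hK, ← mul_le_mul_iff_right₀ (b := z) hσ, hd2']
      constructor <;> intro h <;> linarith
    rw [law (fun x ↦ max (Real.exp x - K) 0) (by fun_prop), ← neg_sq σ,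
      integral_gaussianReal_eq_integral_stdNormalPdf μ (-σ) (by fun_prop),
      integral_max_zero_mul_eq_setIntegral hsign, setIntegral_Iic_exp_sub_mul_stdNormalPdf,
      show d2 - -σ = d1 by rw [hd2]; ring]
  · have hsign (z : ℝ) : 0 ≤ K - Real.exp (μ + σ * z) ↔ z ≤ -d2 := by
      rw [sub_nonneg, ← Real.le_log_iff_exp_le hK, ← mul_le_mul_iff_right₀ (b := z) hσ, mul_neg, hd2']
      constructor <;> intro h <;> linarith
    rw [law (fun x ↦ max (K - Real.exp x) 0) (by fun_prop),
      integral_gaussianReal_eq_integral_stdNormalPdf μ σ (by fun_prop),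
      integral_max_zero_mul_eq_setIntegral hsign]
    have h := setIntegral_Iic_exp_sub_mul_stdNormalPdf μ σ K (-d2)
    rw [show -d2 - σ = -d1 by rw [hd2]; ring] at h
    rw [← neg_sub (Real.exp _ * _), ← h, ← integral_neg]
    simp_rw [← neg_mul, neg_sub]
end

section
/- Let X be a real random variable with distribution N(μ,σ²), σ ≥ 0, and let α, β ∈ ℝ. Then E[Φ(αX + β)] = Φ((αμ + β)/√(1 + α²σ²)). -/
open MeasureTheory ProbabilityTheory

theorem measureReal_conv_Iic (ρ ν : Measure ℝ) [IsFiniteMeasure ρ] [IsFiniteMeasure ν] (b : ℝ) :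
    (ρ ∗ ν).real (Set.Iic b) = ∫ x, ν.real (Set.Iic (b - x)) ∂ρ := by
  have hpre : ∀ x : ℝ, Prod.mk x ⁻¹' ((fun p : ℝ × ℝ ↦ p.1 + p.2) ⁻¹' Set.Iic b) =
      Set.Iic (b - x) := by
    intro x
    ext y
    simp [le_sub_iff_add_le']
  have hms : MeasurableSet ((fun p : ℝ × ℝ ↦ p.1 + p.2) ⁻¹' Set.Iic b) :=
    (measurable_fst.add measurable_snd) measurableSet_Iic
  have hmeas := measurable_measure_prodMk_left (ν := ν) hms
  simp only [hpre] at hmeas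
  simp only [Measure.real]
  rw [integral_toReal hmeas.aemeasurable (.of_forall fun x ↦ measure_lt_top ν _), Measure.conv,
    Measure.map_apply (by fun_prop) measurableSet_Iic, Measure.prod_apply hms]
  simp only [hpre]

theorem stdNormalCdf_eq_measureReal (x : ℝ) :
    stdNormalCdf x = (gaussianReal 0 1).real (Set.Iic x) := by
  rw [Measure.real, gaussianReal_apply_eq_integral 0 one_ne_zero, ENNReal.toReal_ofReal
    (integral_nonneg fun y ↦ gaussianPDFReal_nonneg 0 1 y)]
  simp [stdNormalCdf, stdNormalPdf, gaussianPDFReal]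

theorem gaussianReal_real_Iic (m : ℝ) {v : NNReal} (hv : v ≠ 0) (b : ℝ) :
    (gaussianReal m v).real (Set.Iic b) = stdNormalCdf ((b - m) / Real.sqrt v) := by
  have hs : 0 < Real.sqrt v := Real.sqrt_pos.2 (NNReal.coe_pos.2 (pos_iff_ne_zero.2 hv))
  have hmap : (gaussianReal m v).map (fun x ↦ (x - m) / Real.sqrt v) = gaussianReal 0 1 := by
    have h : (fun x ↦ (x - m) / Real.sqrt v) = (· / Real.sqrt v) ∘ (· - m) := rfl
    rw [h, ← Measure.map_map (by fun_prop) (by fun_prop), gaussianReal_map_sub_const,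
      gaussianReal_map_div_const]
    congr 1
    · simp
    · ext
      simp [hv]
  rw [stdNormalCdf_eq_measureReal, ← hmap, map_measureReal_apply (by fun_prop) measurableSet_Iic]
  congr 1
  ext x
  simp [div_le_div_iff_of_pos_right hs]

/-- identity (eq092) in the proof of Lemma 5: for `X ∼ N(μ,σ²)` with
`σ ≥ 0` and `α, β ∈ ℝ`, `E[Φ(αX + β)] = Φ((αμ + β)/√(1 + α²σ²))`. -/
theorem expectation_of_normal_cdf
    {Ω : Type*} [MeasurableSpace Ω] (P : Measure Ω) [IsProbabilityMeasure P]
    (μ σ : ℝ) (hσ : 0 ≤ σ)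
    (X : Ω → ℝ) (hXm : Measurable X)
    (hX : Measure.map X P = gaussianReal μ (Real.toNNReal (σ ^ 2)))
    (α β : ℝ) :
    ∫ ω, stdNormalCdf (α * X ω + β) ∂P =
      stdNormalCdf ((α * μ + β) / Real.sqrt (1 + α ^ 2 * σ ^ 2)) := by
  have hlaw : P.map (fun ω ↦ -α * X ω) =
      gaussianReal (-α * μ) (.mk ((-α) ^ 2) (sq_nonneg _) * Real.toNNReal (σ ^ 2)) := by
    have h : (fun ω ↦ -α * X ω) = (-α * ·) ∘ X := rfl
    rw [h, ← Measure.map_map (by fun_prop) hXm, hX, gaussianReal_map_const_mul]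
  have hmeas : Measurable stdNormalCdf := by
    have hmono : Monotone stdNormalCdf := fun x y hxy ↦ by
      simp only [stdNormalCdf_eq_measureReal]
      exact measureReal_mono (Set.Iic_subset_Iic.2 hxy)
    exact hmono.measurable
  calc ∫ ω, stdNormalCdf (α * X ω + β) ∂P
      = ∫ y, stdNormalCdf (β - y) ∂(P.map fun ω ↦ -α * X ω) := by
        rw [integral_map (by fun_prop)
          (by fun_prop : Measurable fun y ↦ stdNormalCdf (β - y)).aestronglyMeasurable]
        congr with ω
        ring_nf
    _ = ((P.map fun ω ↦ -α * X ω) ∗ gaussianReal 0 1).real (Set.Iic β) := by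
        rw [hlaw, measureReal_conv_Iic]
        simp only [stdNormalCdf_eq_measureReal]
    _ = stdNormalCdf ((α * μ + β) / Real.sqrt (1 + α ^ 2 * σ ^ 2)) := by
        rw [hlaw, gaussianReal_conv_gaussianReal, gaussianReal_real_Iic _ (by positivity)]
        congr 2
        · ring
        · simp [Real.coe_toNNReal _ (sq_nonneg σ), add_comm]
end
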